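/- arXiv:2601.09991 — 3 statements merged into one kernel-verified Lean document; each statement's English description precedes it below -/
import Mathlib

section
/- Let X = {(x, y, z) ∈ ℝ³ : z² − x³y³ = 0} and let u = (u₁, u₂, 0) ∈ ℝ³ with u₁ u₂ < 0. Then T²_{0,u}X = ∅. -/
open Filter Topology

/-- The directional second-order tangent set `T²_{p,u} X` of a subset of a real
normed space. -/
def secondTangentSet {E : Type*} [NormedAddCommGroup E] [NormedSpace ℝ E]
    (X : Set E) (p u : E) : Set E :=
  {w | ∃ t : ℕ → ℝ, ∃ W : ℕ → E,
    (∀ k, 0 < t k) ∧ Tendsto t atTop (𝓝 0) ∧ Tendsto W atTop (𝓝 w) ∧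
    ∀ k, p + t k • u + ((1 / 2 : ℝ) * t k ^ 2) • W k ∈ X}

/-- For `X = {z² = x³y³} ⊆ ℝ³` and `u = (u₁,u₂,0)` with
`u₁u₂ < 0`, the second-order tangent set `T²_{0,u} X` is empty. -/
theorem stmt16 (u₁ u₂ : ℝ) (hu : u₁ * u₂ < 0) :
    secondTangentSet {q : ℝ × ℝ × ℝ | q.2.2 ^ 2 - q.1 ^ 3 * q.2.1 ^ 3 = 0}
        0 (u₁, u₂, 0) = ∅ := by
  rw [Set.eq_empty_iff_forall_notMem]
  rintro w ⟨t, W, ht, ht0, hW, hX⟩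
  have hx : Tendsto (fun k => u₁ + 1 / 2 * t k * (W k).1) atTop (𝓝 u₁) := by
    simpa using tendsto_const_nhds.add
      ((tendsto_const_nhds.mul ht0).mul ((continuous_fst.tendsto w).comp hW))
  have hy : Tendsto (fun k => u₂ + 1 / 2 * t k * (W k).2.1) atTop (𝓝 u₂) := by
    simpa using tendsto_const_nhds.add
      ((tendsto_const_nhds.mul ht0).mul (((continuous_fst.comp continuous_snd).tendsto w).comp hW))
  obtain ⟨k, hk⟩ := ((hx.mul hy).eventually_lt_const hu).exists
  have hXk := hX k
  simp only [Set.mem_ofPred_eq, Prod.fst_add, Prod.snd_add, Prod.smul_fst, Prod.smul_snd,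
    smul_eq_mul, zero_add, mul_zero] at hXk
  have hcube := Odd.pow_neg (n := 3) (by decide) (mul_neg_of_pos_of_neg (pow_pos (ht k) 2) hk)
  linarith [sq_nonneg (1 / 2 * t k ^ 2 * (W k).2.2)]
end

section
/- Let X = {(x, y, z) ∈ ℝ³ : z² − x³y³ = 0} and let u = (u₁, u₂, 0) ∈ ℝ³ with u₁ u₂ > 0. Then T²_{0,u}X = {(w₁, w₂, 0) : w₁, w₂ ∈ ℝ}. -/
open Filter Topology

/-- For `X = {z² = x³y³} ⊆ ℝ³` and `u = (u₁,u₂,0)` with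
`u₁u₂ > 0`, one has `T²_{0,u} X = {(w₁,w₂,0)}`. -/
theorem stmt17 (u₁ u₂ : ℝ) (hu : 0 < u₁ * u₂) :
    secondTangentSet {q : ℝ × ℝ × ℝ | q.2.2 ^ 2 - q.1 ^ 3 * q.2.1 ^ 3 = 0}
        0 (u₁, u₂, 0) = {w : ℝ × ℝ × ℝ | w.2.2 = 0} := by
  ext w
  obtain ⟨w₁, w₂, w₃⟩ := w
  simp only [secondTangentSet, Set.mem_ofPred_eq]
  constructor
  · rintro ⟨t, W, ht, ht0, hW, hX⟩
    have h₁ : Tendsto (fun k => (W k).1) atTop (𝓝 w₁) := hW.fst_nhds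
    have h₂ : Tendsto (fun k => (W k).2.1) atTop (𝓝 w₂) := hW.snd_nhds.fst_nhds
    have h₃ : Tendsto (fun k => (W k).2.2) atTop (𝓝 w₃) := hW.snd_nhds.snd_nhds
    have key : ∀ k, (W k).2.2 ^ 2 = 4 * t k ^ 2 *
        ((u₁ + t k * (W k).1 / 2) * (u₂ + t k * (W k).2.1 / 2)) ^ 3 := by
      intro k
      have h := hX k
      simp only [Prod.fst_add, Prod.snd_add, Prod.smul_fst, Prod.smul_snd, smul_eq_mul,
        Prod.fst_zero, Prod.snd_zero] at h
      have htk : t k ^ 4 ≠ 0 := (pow_pos (ht k) 4).ne'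
      apply mul_left_cancel₀ htk
      linear_combination 4 * h
    have hlim := ((ht0.pow 2).const_mul 4).mul
      ((((ht0.mul h₁).div_const 2).const_add u₁).mul
        (((ht0.mul h₂).div_const 2).const_add u₂) |>.pow 3)
    have heq := tendsto_nhds_unique ((h₃.pow 2).congr key) hlim
    simpa using heq
  · rintro rfl
    let g : ℝ → ℝ := fun s => (u₁ + s * w₁ / 2) * (u₂ + s * w₂ / 2)
    have hg : Continuous g := by fun_prop
    have hpos : ∀ᶠ s in 𝓝 (0 : ℝ), 0 < g s :=
      hg.continuousAt.eventually (lt_mem_nhds (show 0 < g 0 by simpa [g] using hu))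
    have hs : Tendsto (fun n : ℕ => 1 / ((n : ℝ) + 1)) atTop (𝓝 0) :=
      tendsto_one_div_add_atTop_nhds_zero_nat
    obtain ⟨N, hN⟩ := eventually_atTop.1 (hs.eventually hpos)
    let t : ℕ → ℝ := fun k => 1 / (((k + N : ℕ) : ℝ) + 1)
    have ht : Tendsto t atTop (𝓝 0) := hs.comp (tendsto_add_atTop_nat N)
    let f : ℝ → ℝ × ℝ × ℝ := fun s => (w₁, w₂, 2 * s * √(g s ^ 3))
    have hf : Continuous f := by fun_prop
    refine ⟨t, f ∘ t, fun k => by positivity, ht, ?_, fun k => ?_⟩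
    · simpa [f] using (hf.tendsto 0).comp ht
    · have hsq := Real.sq_sqrt (pow_pos (hN (k + N) (Nat.le_add_left N k)) 3).le
      change √(g (t k) ^ 3) ^ 2 = g (t k) ^ 3 at hsq
      simp only [f, Function.comp_apply, Prod.fst_add, Prod.snd_add, Prod.smul_fst,
        Prod.smul_snd, smul_eq_mul, Prod.fst_zero, Prod.snd_zero]
      have hgt : g (t k) = (u₁ + t k * w₁ / 2) * (u₂ + t k * w₂ / 2) := rfl
      generalize √(g (t k) ^ 3) = r at hsq ⊢
      rw [hgt] at hsq
      linear_combination t k ^ 6 * hsq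
end

section
/- Let X = {(x, y, z) ∈ ℝ³ : z² − x³y³ = 0} and let u = (0, u₂, 0) ∈ ℝ³ with u₂ ≠ 0. Then T²_{0,u}X = {(w₁, w₂, 0) : w₁, w₂ ∈ ℝ, w₁ u₂ ≥ 0}. -/
open Filter Topology

/-- The defining equation of `{z² = x³y³}` along `t • (0, u₂, 0) + (t² / 2) • (a, b, c)`, after
division by `t⁴ / 4`. -/
theorem curve_mem_iff {u₂ t : ℝ} (ht : t ≠ 0) (w : ℝ × ℝ × ℝ) :
    (0 : ℝ × ℝ × ℝ) + t • ((0, u₂, 0) : ℝ × ℝ × ℝ) + ((1 / 2 : ℝ) * t ^ 2) • w ∈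
        {q : ℝ × ℝ × ℝ | q.2.2 ^ 2 - q.1 ^ 3 * q.2.1 ^ 3 = 0} ↔
      w.2.2 ^ 2 = t ^ 5 / 2 * (w.1 * (u₂ + t * w.2.1 / 2)) ^ 3 := by
  simp only [Set.mem_ofPred_eq, Prod.fst_add, Prod.snd_add, Prod.smul_fst, Prod.smul_snd,
    Prod.fst_zero, Prod.snd_zero, smul_eq_mul]
  have h4 : t ^ 4 / 4 ≠ 0 := by positivity
  rw [← sub_eq_zero (a := w.2.2 ^ 2),
    ← mul_eq_zero_iff_left h4 (b := w.2.2 ^ 2 - t ^ 5 / 2 * (w.1 * (u₂ + t * w.2.1 / 2)) ^ 3)]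
  ring_nf

/-- For `X = {z² = x³y³} ⊆ ℝ³` and `u = (0,u₂,0)` with `u₂ ≠ 0`,
one has `T²_{0,u} X = {(w₁,w₂,0) : w₁u₂ ≥ 0}`. -/
theorem stmt18 (u₂ : ℝ) (hu : u₂ ≠ 0) :
    secondTangentSet {q : ℝ × ℝ × ℝ | q.2.2 ^ 2 - q.1 ^ 3 * q.2.1 ^ 3 = 0}
        0 (0, u₂, 0)
      = {w : ℝ × ℝ × ℝ | w.2.2 = 0 ∧ 0 ≤ w.1 * u₂} := by
  ext w
  constructor
  · rintro ⟨t, W, ht, ht0, hW, hX⟩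
    have hX' k := (curve_mem_iff (ht k).ne' (W k)).1 (hX k)
    have h1 : Tendsto (fun k => (W k).1) atTop (𝓝 w.1) := (continuous_fst.tendsto w).comp hW
    have h2 : Tendsto (fun k => (W k).2.1) atTop (𝓝 w.2.1) :=
      ((continuous_fst.comp continuous_snd).tendsto w).comp hW
    have h3 : Tendsto (fun k => (W k).2.2) atTop (𝓝 w.2.2) :=
      ((continuous_snd.comp continuous_snd).tendsto w).comp hW
    have hxy : Tendsto (fun k => (W k).1 * (u₂ + t k * (W k).2.1 / 2)) atTop
        (𝓝 (w.1 * u₂)) := by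
      simpa using h1.mul (((ht0.mul h2).div_const 2).const_add u₂)
    constructor
    · have hz : Tendsto (fun k => (W k).2.2 ^ 2) atTop (𝓝 0) := by
        simp only [hX']
        simpa using ((ht0.pow 5).div_const 2).mul (hxy.pow 3)
      exact pow_eq_zero_iff two_ne_zero |>.1 (tendsto_nhds_unique (h3.pow 2) hz)
    · refine ge_of_tendsto' hxy fun k => ?_
      have hpos : 0 < t k ^ 5 / 2 := by have := ht k; positivity
      have hnn := (hX' k) ▸ sq_nonneg (W k).2.2
      exact (Odd.pow_nonneg_iff (by decide)).1 (nonneg_of_mul_nonneg_right hnn hpos)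
  · obtain ⟨a, b, c⟩ := w
    rintro ⟨hc, hau⟩
    simp only at hc hau
    subst hc
    set τ : ℝ := |u₂| / (1 + |b|) with hτ
    have hτ0 : 0 < τ := by positivity
    have hτb : τ * |b| ≤ |u₂| := by
      rw [hτ, div_mul_eq_mul_div, div_le_iff₀ (by positivity)]
      nlinarith [abs_nonneg u₂]
    set t : ℕ → ℝ := fun k => τ * (1 / ((k : ℝ) + 1)) with ht_def
    have ht k : 0 < t k := by positivity
    have ht0 : Tendsto t atTop (𝓝 0) := by
      simpa [ht_def] using (tendsto_one_div_add_atTop_nhds_zero_nat (𝕜 := ℝ)).const_mul τ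
    have htτ k : t k ≤ τ := by
      refine mul_le_of_le_one_right hτ0.le ?_
      rw [div_le_one (by positivity)]
      linarith [(Nat.cast_nonneg k : (0 : ℝ) ≤ k)]
    have hnn k : 0 ≤ a * (u₂ + t k * b / 2) := by
      have htb : |t k * b| ≤ |u₂| := by
        rw [abs_mul, abs_of_pos (ht k)]
        exact (mul_le_mul_of_nonneg_right (htτ k) (abs_nonneg b)).trans hτb
      have hs : 0 ≤ u₂ * (u₂ + t k * b / 2) := by
        have : |u₂ * (t k * b)| ≤ u₂ ^ 2 := by
          rw [abs_mul, ← sq_abs u₂, sq]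
          exact mul_le_mul_of_nonneg_left htb (abs_nonneg _)
        nlinarith [neg_abs_le (u₂ * (t k * b)), sq_nonneg u₂]
      have hu2 : 0 < u₂ ^ 2 := by positivity
      refine nonneg_of_mul_nonneg_right (a := u₂ ^ 2) ?_ hu2
      linarith [mul_nonneg hau hs]
    let f : ℝ → ℝ := fun s => √(s ^ 5 / 2 * (a * (u₂ + s * b / 2)) ^ 3)
    have hf : Tendsto (fun k => f (t k)) atTop (𝓝 0) := by
      have hcont : Continuous f := by fun_prop
      have := (hcont.tendsto 0).comp ht0
      simpa [f, Function.comp_def] using this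
    refine ⟨t, fun k => (a, b, f (t k)), ht, ht0,
      tendsto_const_nhds.prodMk_nhds (tendsto_const_nhds.prodMk_nhds hf), fun k => ?_⟩
    refine (curve_mem_iff (ht k).ne' _).2 (Real.sq_sqrt ?_)
    have := ht k
    have := hnn k
    positivity
end
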